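/- Let R be a commutative ring, V a finite free R-module with flag V_1 ⊂ ... ⊂ V_k, τ a cyclic endomorphism of V preserving the flag, and g ∈ Aut_R(V) such that (1) gτg^{−1} preserves the flag and (2) for each j, the induced actions of τ and gτg^{−1} on V_j/V_{j−1} have the same characteristic polynomial. Then g preserves the flag. -/

import Mathlib

section Flags

variable {R V : Type*} [CommRing R] [AddCommGroup V] [Module R V]

/-- `v` generates the module under the action of `R[τ]`. -/
def IsCyclicVec (τ : Module.End R V) (v : V) : Prop :=
  ∀ w : V, ∃ p : Polynomial R, Polynomial.aeval τ p v = w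

/-- `τ` is cyclic: it admits a cyclic vector. -/
def IsCyclicEnd (τ : Module.End R V) : Prop := ∃ v, IsCyclicVec τ v

/-- The `j`-th step `V_j` of the flag, viewed inside `V_{j+1}`. -/
abbrev flagSub {k : ℕ} (W : Fin (k + 1) → Submodule R V) (j : Fin k) :
    Submodule R (W j.succ) :=
  (W j.castSucc).comap (W j.succ).subtype

/-- The `j`-th subquotient `V_{j+1}/V_j` of the flag. -/
abbrev FlagQuot {k : ℕ} (W : Fin (k + 1) → Submodule R V) (j : Fin k) :=
  W j.succ ⧸ flagSub W j

/-- The endomorphism induced on the subquotient `V_{j+1}/V_j` by a flag-preserving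
endomorphism `τ`. -/
def inducedEnd {k : ℕ} (W : Fin (k + 1) → Submodule R V) (τ : Module.End R V)
    (hτ : ∀ j, ∀ x ∈ W j, τ x ∈ W j) (j : Fin k) :
    Module.End R (FlagQuot W j) :=
  Submodule.mapQ (flagSub W j) (flagSub W j)
    (τ.restrict (fun x hx => hτ j.succ x hx))
    (fun x hx => hτ j.castSucc x.1 hx)

end Flags

open Polynomial in
/-- A polynomial that annihilates a cyclic vector is a multiple of the characteristic polynomial. -/
theorem IsCyclicVec.charpoly_dvd {R M : Type*} [CommRing R] [AddCommGroup M] [Module R M]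
    [Module.Free R M] [Module.Finite R M] {σ : Module.End R M} {m : M}
    (hm : IsCyclicVec σ m) {p : R[X]} (hp : aeval σ p m = 0) :
    σ.charpoly ∣ p := by
  nontriviality R
  have hmonic : σ.charpoly.Monic := σ.charpoly_monic
  have hmod (q : R[X]) : aeval σ (q %ₘ σ.charpoly) = aeval σ q :=
    aeval_modByMonic_eq_self_of_root σ.aeval_self_charpoly
  have hdeg (q : R[X]) : q %ₘ σ.charpoly ∈ degreeLT R (Module.finrank R M) := by
    rw [mem_degreeLT, ← σ.charpoly_natDegree, ← degree_eq_natDegree hmonic.ne_zero]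
    exact degree_modByMonic_lt q hmonic
  let f : degreeLT R (Module.finrank R M) →ₗ[R] M :=
    LinearMap.applyₗ m ∘ₗ (aeval σ).toLinearMap ∘ₗ Submodule.subtype _
  have hf : Function.Surjective f := fun w => by
    obtain ⟨q, rfl⟩ := hm w
    exact ⟨⟨_, hdeg q⟩, by simp [f, hmod]⟩
  let e : degreeLT R (Module.finrank R M) ≃ₗ[R] M :=
    (degreeLTEquiv R _).trans (Module.finBasis R M).equivFun.symm
  have hinj := OrzechProperty.injective_of_surjective_of_injective e.toLinearMap f e.injective hf
  rw [← modByMonic_eq_zero_iff_dvd hmonic]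
  have h : (⟨_, hdeg p⟩ : degreeLT R (Module.finrank R M)) = 0 :=
    hinj (by simp [f, hmod, hp])
  simpa using h

open Polynomial in
theorem aeval_inducedEnd_mk {R V : Type*} [CommRing R] [AddCommGroup V] [Module R V]
    {k : ℕ} (W : Fin (k + 1) → Submodule R V) (τ : Module.End R V)
    (hτ : ∀ j, ∀ x ∈ W j, τ x ∈ W j) (j : Fin k) (p : R[X]) (x : W j.succ) :
    ∃ h : aeval τ p x.1 ∈ W j.succ,
      aeval (inducedEnd W τ hτ j) p ((flagSub W j).mkQ x) = (flagSub W j).mkQ ⟨_, h⟩ := by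
  induction p using Polynomial.induction_on' with
  | add p q hp hq =>
    obtain ⟨h₁, e₁⟩ := hp
    obtain ⟨h₂, e₂⟩ := hq
    refine ⟨by simpa using add_mem h₁ h₂, ?_⟩
    rw [map_add, LinearMap.add_apply, e₁, e₂, ← map_add]
    congr 1
    ext
    simp
  | monomial n a =>
    have key : ∃ h : (τ ^ n) x.1 ∈ W j.succ,
        (inducedEnd W τ hτ j ^ n) ((flagSub W j).mkQ x) = (flagSub W j).mkQ ⟨_, h⟩ := by
      induction n with
      | zero => exact ⟨x.2, rfl⟩
      | succ n ih =>
        obtain ⟨h, e⟩ := ih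
        refine ⟨by rw [pow_succ']; exact hτ _ _ h, ?_⟩
        rw [pow_succ', Module.End.mul_apply, e]
        simp only [pow_succ']
        rfl
    obtain ⟨h, e⟩ := key
    refine ⟨by simpa [aeval_monomial] using (W j.succ).smul_mem a h, ?_⟩
    simp only [aeval_monomial, Module.End.mul_apply, Module.algebraMap_end_apply, e]
    rfl

open Polynomial in
/-- If `V_{j+1}` is generated by `Q(τ) v`, then `V_j` is generated by `χ(τ) Q(τ) v`, where `χ` is
the characteristic polynomial of the action on `V_{j+1}/V_j`. -/
theorem mem_castSucc_iff_of_mem_succ_iff {R V : Type*} [CommRing R] [AddCommGroup V] [Module R V]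
    {k : ℕ} {W : Fin (k + 1) → Submodule R V} (hmono : Monotone W) {τ : Module.End R V}
    (hτ : ∀ j, ∀ x ∈ W j, τ x ∈ W j) (j : Fin k)
    [Module.Finite R (FlagQuot W j)] [Module.Free R (FlagQuot W j)] {v : V} {Q : R[X]}
    (hQ : ∀ x, x ∈ W j.succ ↔ ∃ p : R[X], aeval τ (p * Q) v = x) (x : V) :
    x ∈ W j.castSucc ↔
      ∃ p : R[X], aeval τ (p * ((inducedEnd W τ hτ j).charpoly * Q)) v = x := by
  have hw : aeval τ Q v ∈ W j.succ := (hQ _).2 ⟨1, by simp⟩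
  have hmem (p : R[X]) : aeval τ (p * Q) v ∈ W j.castSucc ↔
      aeval (inducedEnd W τ hτ j) p ((flagSub W j).mkQ ⟨_, hw⟩) = 0 := by
    obtain ⟨h, e⟩ := aeval_inducedEnd_mk W τ hτ j p ⟨_, hw⟩
    rw [e, Submodule.mkQ_apply, Submodule.Quotient.mk_eq_zero]
    simp
  have hcyc : IsCyclicVec (inducedEnd W τ hτ j) ((flagSub W j).mkQ ⟨_, hw⟩) := fun y => by
    obtain ⟨⟨y, hy⟩, rfl⟩ := (flagSub W j).mkQ_surjective y
    obtain ⟨p, rfl⟩ := (hQ y).1 hy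
    obtain ⟨h, e⟩ := aeval_inducedEnd_mk W τ hτ j p ⟨_, hw⟩
    refine ⟨p, e.trans ?_⟩
    congr 2
    simp
  constructor
  · intro hx
    obtain ⟨p, rfl⟩ := (hQ x).1 (hmono j.castSucc_lt_succ.le hx)
    obtain ⟨q, rfl⟩ := hcyc.charpoly_dvd ((hmem p).1 hx)
    exact ⟨q, by rw [← mul_assoc, mul_comm q]⟩
  · rintro ⟨p, rfl⟩
    rw [← mul_assoc, hmem]
    simp [LinearMap.aeval_self_charpoly]

open Polynomial in
theorem aeval_conj_apply {R V : Type*} [CommRing R] [AddCommGroup V] [Module R V]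
    (τ : Module.End R V) (g : V ≃ₗ[R] V) (p : R[X]) (v : V) :
    aeval (g.toLinearMap ∘ₗ τ ∘ₗ g.symm.toLinearMap) p (g v) = g (aeval τ p v) := by
  have h := LinearMap.congr_fun
    (aeval_algHom_apply (g.conjAlgEquiv R).toAlgHom τ p) (g v)
  exact h.trans (congrArg (fun y => g (aeval τ p y)) (g.symm_apply_apply v))

/-- Let `R` be a commutative ring, `V` a finite free `R`-module with a flag, `τ` a cyclic
endomorphism of `V` preserving the flag, and `g ∈ Aut_R(V)` such that `gτg⁻¹` preserves the
flag and, for each `j`, the actions induced by `τ` and `gτg⁻¹` on `V_j/V_{j-1}` have the same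
characteristic polynomial.  Then `g` preserves the flag. -/
theorem stmt_7 {R V : Type*} [CommRing R] [AddCommGroup V] [Module R V]
    [Module.Free R V] [Module.Finite R V]
    (k : ℕ) (W : Fin (k + 1) → Submodule R V)
    [∀ j : Fin k, Module.Finite R (FlagQuot W j)]
    [∀ j : Fin k, Module.Free R (FlagQuot W j)]
    (hmono : Monotone W) (hbot : W 0 = ⊥) (htop : W (Fin.last k) = ⊤)
    (hWfree : ∀ j, Module.Free R (W j))
    (τ : Module.End R V) (hcyc : IsCyclicEnd τ)
    (hτ : ∀ j, ∀ x ∈ W j, τ x ∈ W j)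
    (g : V ≃ₗ[R] V)
    (hτ' : ∀ j, ∀ x ∈ W j, (g.toLinearMap ∘ₗ τ ∘ₗ g.symm.toLinearMap) x ∈ W j)
    (hchar : ∀ j : Fin k,
      LinearMap.charpoly (inducedEnd W τ hτ j) =
        LinearMap.charpoly
          (inducedEnd W (g.toLinearMap ∘ₗ τ ∘ₗ g.symm.toLinearMap) hτ' j)) :
    ∀ j, ∀ x ∈ W j, g x ∈ W j := by
  obtain ⟨v, hv⟩ := hcyc
  have key (j : Fin (k + 1)) : ∃ Q : Polynomial R,
      (∀ x, x ∈ W j ↔ ∃ p : Polynomial R, Polynomial.aeval τ (p * Q) v = x) ∧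
      (∀ x, x ∈ W j ↔ ∃ p : Polynomial R, Polynomial.aeval
        (g.toLinearMap ∘ₗ τ ∘ₗ g.symm.toLinearMap) (p * Q) (g v) = x) := by
    induction j using Fin.reverseInduction with
    | last =>
      refine ⟨1, fun x => ?_, fun x => ?_⟩
      · simpa [htop] using hv x
      · obtain ⟨p, hp⟩ := hv (g.symm x)
        simpa [htop, aeval_conj_apply] using ⟨p, by rw [hp, g.apply_symm_apply]⟩
    | cast j ih =>
      obtain ⟨Q, h₁, h₂⟩ := ih
      refine ⟨_, mem_castSucc_iff_of_mem_succ_iff hmono hτ j h₁, ?_⟩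
      rw [hchar j]
      exact mem_castSucc_iff_of_mem_succ_iff hmono hτ' j h₂
  intro j x hx
  obtain ⟨Q, h₁, h₂⟩ := key j
  obtain ⟨p, rfl⟩ := (h₁ x).1 hx
  exact (h₂ _).2 ⟨p, aeval_conj_apply τ g _ v⟩
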